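/- Let f ≥ 3 be an odd integer, let S = PSL₂(3^f), and let G be a group with Inn(S) ≤ G ≤ Aut(S) such that the quotient G/Inn(S) is cyclic and generated by (the image of) a field automorphism of odd order dividing f. Then G has at most two rational irreducible complex characters of odd degree; namely, every rational irreducible character of G other than the trivial character and the unique rational extension to G of the Steinberg character of S has even degree and its kernel does not contain Inn(S). -/

import Mathlib

open CategoryTheory

/-- An element `x` of a finite group is *rational* if it is conjugate to every
generator of the cyclic group `⟨x⟩`. -/
def IsRationalElement {G : Type*} [Group G] (x : G) : Prop :=
  ∀ y : G, Subgroup.zpowers y = Subgroup.zpowers x → IsConj x y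

instance : Fact (Nat.Prime 3) := ⟨by norm_num⟩

/-- `SL₂(F)`. -/
abbrev SL2 (F : Type*) [CommRing F] := Matrix.SpecialLinearGroup (Fin 2) F

/-- `PSL₂(F) = SL₂(F)/Z(SL₂(F))`. -/
abbrev PSL2 (F : Type*) [CommRing F] := SL2 F ⧸ Subgroup.center (SL2 F)

/-- `PGL₂(F) = GL₂(F)/Z(GL₂(F))`. -/
abbrev PGL2 (F : Type*) [CommRing F] :=
  Matrix.GeneralLinearGroup (Fin 2) F ⧸
    Subgroup.center (Matrix.GeneralLinearGroup (Fin 2) F)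

/-- The subgroup of inner automorphisms of `S` inside `Aut(S)`. -/
def innAut (S : Type*) [Group S] : Subgroup (MulAut S) :=
  (MulAut.conj : S →* MulAut S).range

instance innAut_normal (S : Type*) [Group S] : (innAut S).Normal := by
  constructor
  rintro α ⟨s, rfl⟩ β
  refine ⟨β s, ?_⟩
  ext x
  simp [MulAut.conj]

/-- `α` is a field automorphism of `PSL₂(F)` if it is induced by a ring automorphism
of `F` applied entrywise. -/
def IsFieldAutPSL2 {F : Type*} [Field F] (α : MulAut (PSL2 F)) : Prop :=
  ∃ σ : F ≃+* F, ∀ A : SL2 F,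
    α (QuotientGroup.mk A) =
      QuotientGroup.mk (Matrix.SpecialLinearGroup.map (σ : F →+* F) A)


section aux

lemma aux_trace {V : Type*} [AddCommGroup V] [Module ℂ V] [FiniteDimensional ℂ V]
    (f g : Module.End ℂ V) (n : ℕ) (hn : 0 < n) (hf : f ^ n = 1) (hg : g * f = 1) :
    ∃ (s : Finset ℂ) (d : ℂ → ℕ), (∀ μ ∈ s, μ ^ n = 1) ∧
      LinearMap.trace ℂ V f = ∑ μ ∈ s, (d μ : ℂ) * μ ∧
      LinearMap.trace ℂ V g = ∑ μ ∈ s, (d μ : ℂ) * μ⁻¹ := by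
  classical
  have hss : f.IsSemisimple := by
    apply Module.End.isSemisimple_of_squarefree_aeval_eq_zero
      (p := (Polynomial.X ^ n - 1 : Polynomial ℂ))
    · apply Polynomial.Separable.squarefree
      exact Polynomial.separable_X_pow_sub_C (1 : ℂ) (by exact_mod_cast hn.ne') one_ne_zero
    · simp [hf]
  have htop : ⨆ μ, f.eigenspace μ = ⊤ := by
    have h := Module.End.iSup_maxGenEigenspace_eq_top f
    simpa [hss.isFinitelySemisimple.maxGenEigenspace_eq_eigenspace] using h
  have hIntl : DirectSum.IsInternal (fun μ => f.eigenspace μ) := by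
    apply (DirectSum.isInternal_submodule_iff_iSupIndep_and_iSup_eq_top _).2
    exact ⟨f.eigenspaces_iSupIndep, htop⟩
  have hfin : {μ | f.eigenspace μ ≠ ⊥}.Finite :=
    WellFoundedGT.finite_ne_bot_of_iSupIndep f.eigenspaces_iSupIndep
  have hpow : ∀ (μ : ℂ) (v : V), f v = μ • v → ∀ k : ℕ, (f ^ k) v = μ ^ k • v := by
    intro μ v hv k
    induction k with
    | zero => simp
    | succ k ih => rw [pow_succ', Module.End.mul_apply, ih, map_smul, hv, smul_smul, pow_succ]
  have hμ : ∀ μ, f.eigenspace μ ≠ ⊥ → μ ^ n = 1 := by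
    intro μ h
    obtain ⟨v, hv, hv0⟩ := Submodule.exists_mem_ne_zero_of_ne_bot h
    have := hpow μ v (Module.End.mem_eigenspace_iff.1 hv) n
    rw [hf, Module.End.one_apply] at this
    by_contra hne
    have h2 : (μ ^ n - 1) • v = 0 := by rw [sub_smul, ← this]; simp
    rcases smul_eq_zero.1 h2 with h3 | h3
    · exact hne (sub_eq_zero.1 h3)
    · exact hv0 h3
  have hgv : ∀ μ, ∀ v ∈ f.eigenspace μ, g v = μ⁻¹ • v := by
    intro μ v hv
    by_cases h0 : v = 0
    · simp [h0]
    have hm : μ ^ n = 1 := hμ μ (fun h => h0 (by simpa [h] using hv))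
    have hm0 : μ ≠ 0 := by
      rintro rfl
      simp [hn.ne'] at hm
    have h1 : g (f v) = v := by
      rw [← Module.End.mul_apply, hg, Module.End.one_apply]
    rw [Module.End.mem_eigenspace_iff.1 hv, map_smul] at h1
    rw [← h1, smul_smul, h1, inv_mul_cancel₀ hm0, one_smul]
  have mf : ∀ μ, Set.MapsTo f (f.eigenspace μ) (f.eigenspace μ) := by
    intro μ v hv
    have hv' := Module.End.mem_eigenspace_iff.1 hv
    show f v ∈ f.eigenspace μ
    rw [hv']
    exact Submodule.smul_mem _ _ hv
  have mg : ∀ μ, Set.MapsTo g (f.eigenspace μ) (f.eigenspace μ) := by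
    intro μ v hv
    show g v ∈ f.eigenspace μ
    rw [hgv μ v hv]
    exact Submodule.smul_mem _ _ hv
  refine ⟨hfin.toFinset, fun μ => Module.finrank ℂ (f.eigenspace μ), ?_, ?_, ?_⟩
  · intro μ h
    exact hμ μ (by simpa using h)
  · rw [LinearMap.trace_eq_sum_trace_restrict' hIntl hfin mf]
    refine Finset.sum_congr rfl fun μ _ => ?_
    have : f.restrict (mf μ) = μ • LinearMap.id := by
      ext v
      exact Module.End.mem_eigenspace_iff.1 v.2
    rw [this, map_smul, LinearMap.trace_id, smul_eq_mul, mul_comm]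
  · rw [LinearMap.trace_eq_sum_trace_restrict' hIntl hfin mg]
    refine Finset.sum_congr rfl fun μ _ => ?_
    have : g.restrict (mg μ) = μ⁻¹ • LinearMap.id := by
      ext v
      exact hgv μ v v.2
    rw [this, map_smul, LinearMap.trace_id, smul_eq_mul, mul_comm]

lemma aux_int {V : Type*} [AddCommGroup V] [Module ℂ V] [FiniteDimensional ℂ V]
    (f g : Module.End ℂ V) (n : ℕ) (hn : 0 < n) (hf : f ^ n = 1) (hg : g * f = 1)
    (q : ℚ) (hq : LinearMap.trace ℂ V f = (q : ℂ)) :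
    ∃ z : ℤ, LinearMap.trace ℂ V f = (z : ℂ) ∧ LinearMap.trace ℂ V g = (z : ℂ) := by
  obtain ⟨s, d, hs, h1, h2⟩ := aux_trace f g n hn hf hg
  have hIntl : IsIntegral ℤ (q : ℂ) := by
    rw [← hq, h1]
    refine IsIntegral.sum _ fun μ hμ => IsIntegral.mul ?_ ?_
    · exact_mod_cast (isIntegral_algebraMap (R := ℤ) (A := ℂ) (x := (d μ : ℤ)))
    · refine IsIntegral.of_pow hn ?_
      rw [hs μ hμ]
      exact isIntegral_one
  have hIntl' : IsIntegral ℤ q := by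
    have : IsIntegral ℤ (algebraMap ℚ ℂ q) := by simpa using hIntl
    exact (isIntegral_algebraMap_iff (algebraMap ℚ ℂ).injective).1 this
  obtain ⟨z, hz⟩ := IsIntegrallyClosed.isIntegral_iff.1 hIntl'
  have hz' : (q : ℂ) = (z : ℂ) := by rw [← hz]; simp
  refine ⟨z, hq.trans hz', ?_⟩
  have hc : LinearMap.trace ℂ V g = (starRingEnd ℂ) (LinearMap.trace ℂ V f) := by
    rw [h1, h2, map_sum]
    refine Finset.sum_congr rfl fun μ hμ => ?_
    rw [map_mul, Complex.conj_natCast]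
    congr 1
    exact Complex.inv_eq_conj (Complex.norm_eq_one_of_pow_eq_one (hs μ hμ) hn.ne')
  rw [hc, hq, hz']
  simp

lemma aux_fixed {H : Type*} [Group H] [Finite H] (hinv : ∀ h : H, h * h = 1 → h = 1)
    {V : Type*} [AddCommGroup V] [Module ℂ V] [FiniteDimensional ℂ V]
    (ρ : Representation ℂ H V) (hrat : ∀ h, ∃ q : ℚ, LinearMap.trace ℂ V (ρ h) = (q : ℂ))
    (hodd : Odd (Module.finrank ℂ V)) : ∃ v : V, v ≠ 0 ∧ ∀ h, ρ h v = v := by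
  classical
  have := Fintype.ofFinite H
  have key : ∀ h, ∃ z : ℤ, LinearMap.trace ℂ V (ρ h) = (z : ℂ) ∧
      LinearMap.trace ℂ V (ρ h⁻¹) = (z : ℂ) := by
    intro h
    obtain ⟨q, hq⟩ := hrat h
    refine aux_int (ρ h) (ρ h⁻¹) (Nat.card H) Nat.card_pos ?_ ?_ q hq
    · rw [← map_pow, pow_card_eq_one', map_one]
    · rw [← map_mul, inv_mul_cancel, map_one]
  choose z hz1 hz2 using key
  have hzinv : ∀ h, z h⁻¹ = z h := by
    intro h
    have := (hz1 h⁻¹).symm.trans (hz2 h)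
    exact_mod_cast this
  have hz1' : z 1 = Module.finrank ℂ V := by
    have := hz1 1
    rw [map_one, LinearMap.trace_one] at this
    exact_mod_cast this.symm
  by_contra hcon
  push Not at hcon
  have hbot : Representation.invariants ρ = ⊥ := by
    rw [eq_bot_iff]
    intro v hv
    by_contra hv0
    obtain ⟨h, hh⟩ := hcon v hv0
    exact hh (hv h)
  have : Invertible (Nat.card H : ℂ) := invertibleOfNonzero (by
    exact_mod_cast Nat.card_pos.ne')
  have hs := Representation.card_inv_mul_sum_char_eq_finrank ρ
  rw [hbot, finrank_bot] at hs
  have hs2 : ∑ h : H, ρ.character h = 0 := by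
    rcases mul_eq_zero.1 (hs.trans Nat.cast_zero) with h | h
    · exact absurd (inv_eq_zero.1 h) (by exact_mod_cast Nat.card_pos.ne')
    · exact h
  have hs3 : ∑ h : H, z h = 0 := by
    have : ∑ h : H, (z h : ℂ) = 0 := by
      rw [← hs2]
      exact Finset.sum_congr rfl fun h _ => (hz1 h).symm
    exact_mod_cast this
  have hs4 : ∑ h ∈ Finset.univ.erase (1 : H), ((z h : ℤ) : ZMod 2) = 0 := by
    refine Finset.sum_involution (fun h _ => h⁻¹) ?_ ?_ ?_ ?_
    · intro h _
      rw [hzinv]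
      exact CharTwo.add_self_eq_zero _
    · intro h hh _ he
      refine (Finset.mem_erase.1 hh).1 (hinv h ?_)
      nth_rw 1 [← he]
      simp
    · intro h hh
      simpa using hh
    · intro h _
      simp
  have hs5 : ((z 1 : ℤ) : ZMod 2) = 0 := by
    have := congrArg (fun t : ℤ => (t : ZMod 2)) hs3
    simp only [Int.cast_sum, Int.cast_zero] at this
    rwa [← Finset.add_sum_erase _ _ (Finset.mem_univ (1 : H)), hs4, add_zero] at this
  rw [hz1', Int.cast_natCast, ZMod.natCast_eq_zero_iff_even] at hs5
  exact (Nat.not_even_iff_odd.2 hodd) hs5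

lemma aux_perm {G : Type*} [Group G] [Finite G] (N : Subgroup G) {X : Type*} [Fintype X]
    [DecidableEq X] [MulAction G X] (x0 : X)
    (T1 : ∀ x : X, ∃ n ∈ N, n • x0 = x)
    (T2 : ∀ x y : X, x ≠ x0 → y ≠ x0 → ∃ n ∈ N, n • x0 = x0 ∧ n • x = y)
    (M : Submodule ℂ (X → ℂ)) (hM : ∀ n ∈ N, ∀ f ∈ M, (fun x => f (n • x)) ∈ M)
    (f : X → ℂ) (hfM : f ∈ M) (hf0 : f ≠ 0) (hfs : ∑ x, f x = 0)
    (h : X → ℂ) (hs : ∑ x, h x = 0) : h ∈ M := by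
  classical
  have hsum : ∀ (g : G) (k : X → ℂ), ∑ x, k (g • x) = ∑ x, k x := fun g k =>
    Equiv.sum_comp (MulAction.toPerm g) k
  -- move a nonzero value to `x0`
  obtain ⟨f, hfM, hfx, hfs⟩ : ∃ f ∈ M, f x0 ≠ 0 ∧ ∑ x, f x = 0 := by
    obtain ⟨x, hx⟩ := Function.ne_iff.1 hf0
    obtain ⟨n, hn, rfl⟩ := T1 x
    exact ⟨_, hM n hn f hfM, hx, (hsum n f).trans hfs⟩
  let D : Subgroup G := N ⊓ MulAction.stabilizer G x0
  have := Fintype.ofFinite D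
  let k : X → ℂ := fun x => ∑ n : D, f ((n : G) • x)
  have hkM : k ∈ M := by
    have : k = ∑ n : D, fun x => f ((n : G) • x) := by
      ext x
      simp [k]
    rw [this]
    exact Submodule.sum_mem _ fun n _ => hM _ n.2.1 f hfM
  have hks : ∑ x, k x = 0 := by
    simp only [k]
    rw [Finset.sum_comm]
    exact Finset.sum_eq_zero fun n _ => (hsum _ f).trans hfs
  have hk0 : k x0 ≠ 0 := by
    have : k x0 = ∑ n : D, f x0 :=
      Finset.sum_congr rfl fun n _ => congrArg f (MulAction.mem_stabilizer_iff.1 n.2.2)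
    rw [this, Finset.sum_const, nsmul_eq_mul]
    refine mul_ne_zero ?_ hfx
    simp
  have hkc : ∀ x y, x ≠ x0 → y ≠ x0 → k x = k y := by
    intro x y hx hy
    obtain ⟨n, hn, hn0, rfl⟩ := T2 x y hx hy
    let n' : D := ⟨n, hn, MulAction.mem_stabilizer_iff.2 hn0⟩
    refine (Fintype.sum_equiv (Equiv.mulRight n') _ _ fun m => ?_).symm
    simp [n', mul_smul]
  obtain ⟨b, hb⟩ : ∃ b, ∀ x, x ≠ x0 → k x = b := by
    by_cases hX : ∃ x, x ≠ x0
    · obtain ⟨x, hx⟩ := hX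
      exact ⟨k x, fun y hy => hkc y x hy hx⟩
    · push Not at hX
      exact ⟨0, fun x hx => absurd (hX x) hx⟩
  have hab : k x0 - b ≠ 0 := by
    intro he
    have he' : k x0 = b := sub_eq_zero.1 he
    have hall : ∀ x, k x = b := fun x => by
      by_cases hx : x = x0
      · rw [hx, he']
      · exact hb x hx
    have : ∑ x, k x = Fintype.card X * b := by
      simp [hall]
    rw [hks] at this
    rcases mul_eq_zero.1 this.symm with h1 | h1
    · have : Nonempty X := ⟨x0⟩
      exact Fintype.card_ne_zero (α := X) (by exact_mod_cast h1)
    · exact hk0 (he'.trans h1)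
  have hkf : ∀ x, k x = (k x0 - b) * (if x = x0 then 1 else 0) + b := by
    intro x
    by_cases hx : x = x0
    · simp [hx]
    · simp [hx, hb x hx]
  have hd : ∀ x, (Pi.single x 1 - Pi.single x0 1 : X → ℂ) ∈ M := by
    intro x
    obtain ⟨n, hn, rfl⟩ := T1 x
    have h1 := hM n⁻¹ (N.inv_mem hn) k hkM
    have h2 := M.smul_mem (k x0 - b)⁻¹ (M.sub_mem h1 hkM)
    convert h2 using 1
    ext y
    simp only [Pi.sub_apply, Pi.smul_apply, smul_eq_mul]
    rw [hkf (n⁻¹ • y), hkf y]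
    simp only [Pi.single_apply, inv_smul_eq_iff]
    field_simp
    ring
  have hh : h = ∑ x, h x • (Pi.single x 1 - Pi.single x0 1 : X → ℂ) := by
    ext y
    simp only [smul_sub, Finset.sum_sub_distrib, ← Finset.sum_smul, hs, zero_smul, sub_zero]
    simp [Pi.single_apply]
  rw [hh]
  exact Submodule.sum_mem _ fun x _ => M.smul_mem _ (hd x)


lemma aux_perm_rep {G : Type*} [Group G] [Finite G] (N : Subgroup G) {X : Type*} [Fintype X]
    [DecidableEq X] [MulAction G X] (x0 : X)
    (T1 : ∀ x : X, ∃ n ∈ N, n • x0 = x)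
    (T2 : ∀ x y : X, x ≠ x0 → y ≠ x0 → ∃ n ∈ N, n • x0 = x0 ∧ n • x = y)
    {V : Type*} [AddCommGroup V] [Module ℂ V] [FiniteDimensional ℂ V]
    (ρ : Representation ℂ G V)
    (hirr : ∀ M : Submodule ℂ V, (∀ g, ∀ v ∈ M, ρ g v ∈ M) → M = ⊥ ∨ M = ⊤)
    (P : X → V) (hP : ∀ g x, P (g • x) = ρ g (P x)) (hP0 : P x0 ≠ 0) :
    (∀ g, LinearMap.trace ℂ V (ρ g) = 1) ∨
    (Function.Surjective (Fintype.linearCombination ℂ P) ∧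
      (∀ f : X → ℂ, Fintype.linearCombination ℂ P f = 0 ↔ ∃ c : ℂ, ∀ x, f x = c) ∧
      Module.finrank ℂ V + 1 = Fintype.card X ∧
      ∀ M : Submodule ℂ V, (∀ n ∈ N, ∀ v ∈ M, ρ n v ∈ M) → M = ⊥ ∨ M = ⊤) := by
  classical
  have hX : Nonempty X := ⟨x0⟩
  have hcard : (Fintype.card X : ℂ) ≠ 0 := by
    exact_mod_cast Fintype.card_ne_zero
  set L := Fintype.linearCombination ℂ P with hL
  have hLs : ∀ x, L (Pi.single x 1) = P x := by
    intro x
    rw [hL, Fintype.linearCombination_apply_single, one_smul]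
  have hLa : ∀ f, L f = ∑ x, f x • P x := fun f => Fintype.linearCombination_apply ℂ P f
  have hLg : ∀ (g : G) (f : X → ℂ), L (fun x => f (g • x)) = ρ g⁻¹ (L f) := by
    intro g f
    rw [hLa, hLa, map_sum, ← Equiv.sum_comp (MulAction.toPerm g) (fun x => ρ g⁻¹ (f x • P x))]
    refine Finset.sum_congr rfl fun x _ => ?_
    rw [MulAction.toPerm_apply, map_smul, ← hP, inv_smul_smul]
  have hs : ∀ g, ρ g (∑ x, P x) = ∑ x, P x := by
    intro g
    rw [map_sum, ← Equiv.sum_comp (MulAction.toPerm g) P]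
    exact Finset.sum_congr rfl fun x _ => (hP g x).symm
  by_cases hs0 : ∑ x, P x = 0
  swap
  · left
    have hfixM : Representation.invariants ρ = ⊤ := by
      rcases hirr (Representation.invariants ρ) (fun g v hv h => by rw [hv g, hv h]) with h | h
      · exact absurd ((Submodule.eq_bot_iff _).1 h _ hs) hs0
      · exact h
    have htriv : ∀ g, ρ g = 1 := by
      intro g
      ext v
      have : v ∈ Representation.invariants ρ := hfixM ▸ Submodule.mem_top
      exact this g
    have hspan : ℂ ∙ (∑ x, P x) = ⊤ := by
      rcases hirr (ℂ ∙ (∑ x, P x)) (fun g v hv => by simpa [htriv g] using hv) with h | h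
      · exact absurd (Submodule.span_singleton_eq_bot.1 h) hs0
      · exact h
    have hfr : Module.finrank ℂ V = 1 := by
      rw [← finrank_top ℂ V, ← hspan, finrank_span_singleton hs0]
    intro g
    rw [htriv g, LinearMap.trace_one, hfr, Nat.cast_one]
  right
  have hconst : ∀ c : ℂ, L (fun _ => c) = 0 := by
    intro c
    rw [hLa, ← Finset.smul_sum, hs0, smul_zero]
  -- decomposition
  have hdec : ∀ f : X → ℂ, ∃ c : ℂ, ∑ x, (f x - c) = 0 := by
    intro f
    refine ⟨(Fintype.card X : ℂ)⁻¹ * ∑ x, f x, ?_⟩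
    rw [Finset.sum_sub_distrib, Finset.sum_const, Finset.card_univ, nsmul_eq_mul,
      mul_inv_cancel_left₀ hcard, sub_self]
  have hsub : ∀ (f : X → ℂ) (c : ℂ), L (fun x => f x - c) = L f := by
    intro f c
    have : (fun x => f x - c) = f - fun _ => c := rfl
    rw [this, map_sub, hconst, sub_zero]
  -- main dichotomy for N-invariant submodules
  have hmain : ∀ M : Submodule ℂ V, (∀ n ∈ N, ∀ v ∈ M, ρ n v ∈ M) → ∀ f : X → ℂ,
      L f ∈ M → (¬ ∃ c : ℂ, ∀ x, f x = c) → ∀ h, L h ∈ M := by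
    intro M hM f hf hfc h
    obtain ⟨c, hc⟩ := hdec f
    obtain ⟨d, hd⟩ := hdec h
    have := aux_perm N x0 T1 T2 (M.comap L) (fun n hn k hk => by
      rw [Submodule.mem_comap, hLg]
      exact hM _ (N.inv_mem hn) _ hk) (fun x => f x - c) (by
        rw [Submodule.mem_comap, hsub]; exact hf)
      (fun h0 => hfc ⟨c, fun x => sub_eq_zero.1 (congrFun h0 x)⟩) hc (fun x => h x - d) hd
    rwa [Submodule.mem_comap, hsub] at this
  have hker : ∀ f : X → ℂ, L f = 0 ↔ ∃ c : ℂ, ∀ x, f x = c := by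
    intro f
    constructor
    · intro hf
      by_contra hcon
      have := hmain ⊥ (fun n _ v hv => by
        rw [(Submodule.mem_bot ℂ).1 hv, map_zero]; exact Submodule.zero_mem _) f
        (by rw [hf]; exact Submodule.zero_mem _) hcon (Pi.single x0 1)
      rw [hLs, Submodule.mem_bot] at this
      exact hP0 this
    · rintro ⟨c, hc⟩
      have : f = fun _ => c := funext hc
      rw [this, hconst]
  have hsurj : Function.Surjective L := by
    rw [← LinearMap.range_eq_top]
    rcases hirr (LinearMap.range L) (by
      rintro g _ ⟨f, rfl⟩
      refine ⟨fun x => f (g⁻¹ • x), ?_⟩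
      rw [hLg, inv_inv]) with h | h
    · exfalso
      apply hP0
      rw [← hLs, LinearMap.range_eq_bot.1 h, LinearMap.zero_apply]
    · exact h
  refine ⟨hsurj, hker, ?_, ?_⟩
  · have h1 := LinearMap.finrank_range_add_finrank_ker L
    rw [LinearMap.range_eq_top.2 hsurj, finrank_top, Module.finrank_fintype_fun_eq_card] at h1
    have hk : LinearMap.ker L = ℂ ∙ (fun _ => (1 : ℂ)) := by
      ext f
      rw [LinearMap.mem_ker, hker, Submodule.mem_span_singleton]
      constructor
      · rintro ⟨c, hc⟩
        exact ⟨c, by ext x; simp [hc]⟩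
      · rintro ⟨c, rfl⟩
        exact ⟨c, by simp⟩
    rw [hk, finrank_span_singleton] at h1
    · exact h1
    · intro h0
      exact one_ne_zero (congrFun h0 x0)
  · intro M hM
    by_cases hMb : M = ⊥
    · exact Or.inl hMb
    right
    obtain ⟨v, hv, hv0⟩ := Submodule.exists_mem_ne_zero_of_ne_bot hMb
    obtain ⟨f, rfl⟩ := hsurj v
    rw [eq_top_iff]
    intro v' _
    obtain ⟨h, rfl⟩ := hsurj v'
    exact hmain M hM f hv (fun hc => hv0 ((hker f).2 hc)) h

lemma aux_char_eq {G : Type*} [Group G] {X : Type*} [Fintype X] [MulAction G X]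
    {V W : Type*} [AddCommGroup V] [Module ℂ V] [AddCommGroup W] [Module ℂ W]
    (ρ : Representation ℂ G V) (σ : Representation ℂ G W)
    (P : X → V) (hP : ∀ g x, P (g • x) = ρ g (P x))
    (Q : X → W) (hQ : ∀ g x, Q (g • x) = σ g (Q x))
    (h1 : Function.Surjective (Fintype.linearCombination ℂ P))
    (h2 : Function.Surjective (Fintype.linearCombination ℂ Q))
    (hk : LinearMap.ker (Fintype.linearCombination ℂ P) =
      LinearMap.ker (Fintype.linearCombination ℂ Q)) (g : G) :
    LinearMap.trace ℂ V (ρ g) = LinearMap.trace ℂ W (σ g) := by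
  classical
  let e : V ≃ₗ[ℂ] W := (LinearMap.quotKerEquivOfSurjective _ h1).symm ≪≫ₗ
    Submodule.quotEquivOfEq _ _ hk ≪≫ₗ LinearMap.quotKerEquivOfSurjective _ h2
  have he : ∀ f, e (Fintype.linearCombination ℂ P f) = Fintype.linearCombination ℂ Q f := by
    intro f
    have : (LinearMap.quotKerEquivOfSurjective _ h1).symm (Fintype.linearCombination ℂ P f) =
        Submodule.Quotient.mk f := by
      rw [LinearEquiv.symm_apply_eq]
      rfl
    simp only [e, LinearEquiv.trans_apply, this]
    rfl
  have heP : ∀ x, e (P x) = Q x := by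
    intro x
    have := he (Pi.single x 1)
    simpa using this
  rw [← LinearMap.trace_conj' (ρ g) e]
  congr 1
  ext w
  obtain ⟨f, rfl⟩ := h2 w
  rw [← he, LinearEquiv.conj_apply_apply, LinearEquiv.symm_apply_apply, he,
    Fintype.linearCombination_apply, Fintype.linearCombination_apply, map_sum, map_sum, map_sum]
  refine Finset.sum_congr rfl fun x _ => ?_
  rw [map_smul, map_smul, map_smul, ← hP, heP, hQ]

lemma aux_simple_irr {G : Type} [Group G] (V : FDRep ℂ G) (hV : Simple V)
    (M : Submodule ℂ V) (hM : ∀ g, ∀ v ∈ M, V.ρ g v ∈ M) : M = ⊥ ∨ M = ⊤ := by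
  let σ : Representation ℂ G M := (Subrepresentation.mk M (fun g v hv => hM g v hv) :
    Subrepresentation (A := ℂ) (V.ρ : Representation ℂ G V)).toRepresentation
  let ι : FDRep.of σ ⟶ V :=
    ⟨InducedCategory.homMk (ModuleCat.ofHom M.subtype), fun g => by
      ext1
      rfl⟩
  have hinj : Function.Injective ι := Subtype.val_injective
  have hmono : Mono ι := ConcreteCategory.mono_of_injective ι hinj
  by_cases h0 : ι = 0
  · left
    rw [Submodule.eq_bot_iff]
    intro v hv
    have : ι (⟨v, hv⟩ : M) = (0 : FDRep.of σ ⟶ V) (⟨v, hv⟩ : M) := by rw [h0]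
    exact this
  · right
    have hiso : IsIso ι := (Simple.mono_isIso_iff_nonzero ι).2 h0
    rw [eq_top_iff]
    intro v _
    have h1 : ι ((inv ι) v) = v := by
      rw [← ConcreteCategory.comp_apply, IsIso.inv_hom_id]
      rfl
    rw [← h1]
    exact ((inv ι) v : M).2

lemma aux_irr_simple {G : Type} [Group G] [Finite G] (V : FDRep ℂ G)
    (hne : ∃ v : V, v ≠ 0)
    (h : ∀ M : Submodule ℂ V, (∀ g, ∀ v ∈ M, V.ρ g v ∈ M) → M = ⊥ ∨ M = ⊤) : Simple V := by
  obtain ⟨v0, hv0⟩ := hne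
  have hnt : Nontrivial V := ⟨v0, 0, hv0⟩
  rw [FDRep.simple_iff_end_is_rank_one]
  refine (finrank_eq_one_iff_of_nonzero' (𝟙 V) ?_).2 ?_
  · intro h0
    apply hv0
    have : (𝟙 V : V ⟶ V) v0 = (0 : V ⟶ V) v0 := by rw [h0]
    exact this
  · intro φ
    let F : Module.End ℂ V := φ.hom.hom.hom
    have hF : ∀ g v, F (V.ρ g v) = V.ρ g (F v) := by
      intro g v
      exact ConcreteCategory.congr_hom ((forget (FGModuleCat ℂ)).congr_map (φ.comm g)) v
    obtain ⟨μ, hμ⟩ := Module.End.exists_eigenvalue F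
    refine ⟨μ, ?_⟩
    have htop : F.eigenspace μ = ⊤ := by
      rcases h (F.eigenspace μ) (fun g v hv => by
        rw [Module.End.mem_eigenspace_iff] at hv ⊢
        rw [hF, hv, map_smul]) with h | h
      · exact absurd h hμ
      · exact h
    have hFv : ∀ v, F v = μ • v := fun v =>
      Module.End.mem_eigenspace_iff.1 (htop ▸ Submodule.mem_top)
    apply Action.Hom.ext
    apply InducedCategory.hom_ext
    apply ModuleCat.hom_ext
    apply LinearMap.ext
    intro v
    exact (hFv v).symm

lemma aux_main {G : Type} [Group G] [Finite G] (N H : Subgroup G) {F : Type} [Finite F]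
    (u : F → G) (w : G) (huN : ∀ x, u x ∈ N) (hwN : w ∈ N) (huH : ∀ x, u x ∈ H)
    (hcov : ∀ g, g ∈ H ∨ ∃ x, (u x * w)⁻¹ * g ∈ H)
    (hne : ∀ x, u x * w ∉ H)
    (hinj : ∀ x y, (u x * w)⁻¹ * (u y * w) ∈ H → x = y)
    (hinv : ∀ h ∈ H, h * h = 1 → h = 1)
    (V : FDRep ℂ G) (hV : Simple V) (hrat : ∀ g, ∃ q : ℚ, V.character g = (q : ℂ))
    (hodd : Odd (Module.finrank ℂ V)) :
    (∀ g, V.character g = 1) ∨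
    (Module.finrank ℂ V = Nat.card F ∧
      (∀ M : Submodule ℂ V, (∀ n ∈ N, ∀ v ∈ M, V.ρ n v ∈ M) → M = ⊥ ∨ M = ⊤) ∧
      ∀ [Fintype (G ⧸ H)], ∃ P : G ⧸ H → V, (∀ g x, P (g • x) = V.ρ g (P x)) ∧
        Function.Surjective (Fintype.linearCombination ℂ P) ∧
        ∀ f : G ⧸ H → ℂ, Fintype.linearCombination ℂ P f = 0 ↔ ∃ c : ℂ, ∀ x, f x = c) := by
  classical
  obtain ⟨v, hv0, hv⟩ := aux_fixed (H := H) (fun h hh => Subtype.ext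
    (hinv h h.2 (congrArg Subtype.val hh))) (V.ρ.comp H.subtype) (fun h => hrat h) hodd
  let P : G ⧸ H → V := fun x => Quotient.liftOn' x (fun g => V.ρ g v) (by
    intro a b hab
    rw [QuotientGroup.leftRel_apply] at hab
    have h1 : V.ρ (a⁻¹ * b) v = v := hv ⟨_, hab⟩
    have h2 : b = a * (a⁻¹ * b) := by group
    show V.ρ a v = V.ρ b v
    rw [h2, map_mul, Module.End.mul_apply, h1])
  have hPmk : ∀ g : G, P (QuotientGroup.mk g) = V.ρ g v := fun g => rfl
  have hP : ∀ g x, P (g • x) = V.ρ g (P x) := by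
    intro g x
    obtain ⟨a, rfl⟩ := QuotientGroup.mk_surjective x
    rw [MulAction.Quotient.smul_mk, hPmk, hPmk, smul_eq_mul, map_mul, Module.End.mul_apply]
  let x0 : G ⧸ H := QuotientGroup.mk 1
  have hx0 : ∀ g : G, (QuotientGroup.mk g : G ⧸ H) = x0 ↔ g ∈ H := by
    intro g
    rw [eq_comm, QuotientGroup.eq]
    simp
  have hform : ∀ x : G ⧸ H, x = x0 ∨ ∃ t, x = QuotientGroup.mk (u t * w) := by
    intro x
    obtain ⟨a, rfl⟩ := QuotientGroup.mk_surjective x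
    rcases hcov a with h | ⟨t, ht⟩
    · exact Or.inl ((hx0 a).2 h)
    · exact Or.inr ⟨t, (QuotientGroup.eq.2 ht).symm⟩
  have T1 : ∀ x : G ⧸ H, ∃ n ∈ N, n • x0 = x := by
    intro x
    rcases hform x with rfl | ⟨t, rfl⟩
    · exact ⟨1, N.one_mem, one_smul _ _⟩
    · refine ⟨u t * w, N.mul_mem (huN t) hwN, ?_⟩
      simp only [x0, MulAction.Quotient.smul_mk, smul_eq_mul, mul_one]
  have T2 : ∀ x y : G ⧸ H, x ≠ x0 → y ≠ x0 → ∃ n ∈ N, n • x0 = x0 ∧ n • x = y := by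
    intro x y hx hy
    obtain ⟨s, rfl⟩ := (hform x).resolve_left hx
    obtain ⟨t, rfl⟩ := (hform y).resolve_left hy
    refine ⟨u t * (u s)⁻¹, N.mul_mem (huN t) (N.inv_mem (huN s)), ?_, ?_⟩
    · simp only [x0, MulAction.Quotient.smul_mk, smul_eq_mul, mul_one]
      exact (hx0 _).2 (H.mul_mem (huH t) (H.inv_mem (huH s)))
    · simp only [MulAction.Quotient.smul_mk, smul_eq_mul]
      congr 1
      group
  have hcard : Nat.card (G ⧸ H) = Nat.card F + 1 := by
    let e : Option F → G ⧸ H := fun o => o.elim x0 (fun t => QuotientGroup.mk (u t * w))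
    have he : Function.Bijective e := by
      constructor
      · rintro (_ | s) (_ | t) h
        · rfl
        · exact absurd ((hx0 _).1 h.symm) (hne t)
        · exact absurd ((hx0 _).1 h) (hne s)
        · exact congrArg some (hinj s t (QuotientGroup.eq.1 h))
      · intro x
        rcases hform x with rfl | ⟨t, rfl⟩
        · exact ⟨none, rfl⟩
        · exact ⟨some t, rfl⟩
    rw [← Nat.card_eq_of_bijective e he, Finite.card_option]
  by_cases htriv : ∀ g, V.character g = 1
  · exact Or.inl htriv
  right
  have hmain : ∀ [Fintype (G ⧸ H)], _ := fun [Fintype (G ⧸ H)] =>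
    (aux_perm_rep N x0 T1 T2 V.ρ (aux_simple_irr V hV) P hP (by
      show V.ρ 1 v ≠ 0
      rw [map_one]
      exact hv0)).resolve_left htriv
  have := Fintype.ofFinite (G ⧸ H)
  refine ⟨?_, hmain.2.2.2, fun {_} => ⟨P, hP, hmain.1, hmain.2.1⟩⟩
  have h := hmain.2.2.1
  rw [← Nat.card_eq_fintype_card, hcard] at h
  omega

lemma aux_kernel {G : Type} [Group G] [Finite G] (N : Subgroup G) [N.Normal] (τ : G)
    (hgen : ∀ y : G ⧸ N, y ∈ Subgroup.zpowers (QuotientGroup.mk τ : G ⧸ N))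
    (hm : Odd (orderOf (QuotientGroup.mk τ : G ⧸ N)))
    (V : FDRep ℂ G) (hV : Simple V) (hrat : ∀ g, ∃ q : ℚ, V.character g = (q : ℂ))
    (hN : ∀ g ∈ N, V.character g = V.character 1) : ∀ g, V.character g = 1 := by
  classical
  have hN1 : ∀ n ∈ N, V.ρ n = 1 := by
    have := Fintype.ofFinite N
    let σ : Representation ℂ N V := V.ρ.comp N.subtype
    have : Invertible (Nat.card N : ℂ) := invertibleOfNonzero (by
      exact_mod_cast Nat.card_pos.ne')
    have hs := Representation.card_inv_mul_sum_char_eq_finrank σ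
    have hc : ∀ n : N, σ.character n = Module.finrank ℂ V := fun n =>
      (hN n n.2).trans V.char_one
    simp only [hc, Finset.sum_const, Finset.card_univ, nsmul_eq_mul] at hs
    rw [← Nat.card_eq_fintype_card, inv_mul_cancel_left₀
      (by exact_mod_cast Nat.card_pos.ne')] at hs
    have htop : σ.invariants = ⊤ := Submodule.eq_top_of_finrank_eq (by exact_mod_cast hs.symm)
    intro n hn
    ext v
    have : v ∈ σ.invariants := htop ▸ Submodule.mem_top
    exact this ⟨n, hn⟩
  have hpow : ∀ g : G, ∃ k : ℕ, V.ρ g = (V.ρ τ) ^ k := by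
    intro g
    have h := hgen (QuotientGroup.mk g)
    rw [← mem_powers_iff_mem_zpowers] at h
    obtain ⟨k, hk⟩ := h
    refine ⟨k, ?_⟩
    have h1 : (τ ^ k)⁻¹ * g ∈ N := by
      rw [← QuotientGroup.eq, ← hk]
      rfl
    have h2 : g = τ ^ k * ((τ ^ k)⁻¹ * g) := by group
    rw [h2, map_mul, hN1 _ h1, mul_one, map_pow]
  have hirr := aux_simple_irr V hV
  have hnt : ∃ v : V, v ≠ 0 := by
    by_contra hcon
    push Not at hcon
    refine Simple.not_isZero V ?_
    rw [CategoryTheory.Limits.IsZero.iff_id_eq_zero]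
    apply Action.Hom.ext
    apply InducedCategory.hom_ext
    apply ModuleCat.hom_ext
    apply LinearMap.ext
    intro v
    exact (hcon _).trans (hcon _).symm
  obtain ⟨v, hv⟩ := hnt
  have : Nontrivial V := ⟨v, 0, hv⟩
  obtain ⟨μ, hμ⟩ := Module.End.exists_eigenvalue (V.ρ τ : Module.End ℂ V)
  have htop : Module.End.eigenspace (V.ρ τ) μ = ⊤ := by
    rcases hirr (Module.End.eigenspace (V.ρ τ) μ) (fun g v hv => by
      obtain ⟨k, hk⟩ := hpow g
      rw [Module.End.mem_eigenspace_iff] at hv ⊢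
      rw [hk, ← Module.End.mul_apply, (Commute.self_pow (V.ρ τ) k).eq, Module.End.mul_apply, hv,
        map_smul]) with h | h
    · exact absurd h hμ
    · exact h
  have hτ : V.ρ τ = μ • (1 : Module.End ℂ V) := by
    ext v
    exact Module.End.mem_eigenspace_iff.1 (htop ▸ Submodule.mem_top)
  have hspan : ℂ ∙ v = ⊤ := by
    rcases hirr (ℂ ∙ v) (fun g v' hv' => by
      obtain ⟨k, hk⟩ := hpow g
      rw [hk, hτ, smul_pow, one_pow]
      exact Submodule.smul_mem _ _ hv') with h | h
    · exact absurd (Submodule.span_singleton_eq_bot.1 h) hv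
    · exact h
  have hfr : Module.finrank ℂ V = 1 := by
    rw [← finrank_top ℂ V, ← hspan, finrank_span_singleton hv]
  have hμ1 : μ = 1 := by
    obtain ⟨q, hq⟩ := hrat τ
    have h1 : V.character τ = μ := by
      show LinearMap.trace ℂ V (V.ρ τ) = μ
      rw [hτ, map_smul, LinearMap.trace_one, hfr]
      simp
    have h2 : V.ρ (τ ^ orderOf (QuotientGroup.mk τ : G ⧸ N)) = 1 := by
      apply hN1
      rw [← QuotientGroup.eq_one_iff]
      exact pow_orderOf_eq_one (QuotientGroup.mk τ : G ⧸ N)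
    rw [map_pow, hτ, smul_pow, one_pow] at h2
    have h3 : μ ^ orderOf (QuotientGroup.mk τ : G ⧸ N) = 1 := by
      have h4 := congrArg (LinearMap.trace ℂ V) h2
      rw [map_smul, LinearMap.trace_one, hfr] at h4
      simpa using h4
    rw [← h1, hq] at h3 ⊢
    have h5 : q ^ orderOf (QuotientGroup.mk τ : G ⧸ N) = 1 := by exact_mod_cast h3
    have h6 : q = 1 := hm.strictMono_pow.injective (by simpa using h5)
    rw [h6, Rat.cast_one]
  intro g
  obtain ⟨k, hk⟩ := hpow g
  show LinearMap.trace ℂ V (V.ρ g) = 1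
  rw [hk, hτ, hμ1, one_smul, one_pow, LinearMap.trace_one, hfr, Nat.cast_one]

lemma auxSL2_mul {F : Type*} [CommRing F] (A B : SL2 F) (i j : Fin 2) :
    (A * B) i j = A i 0 * B 0 j + A i 1 * B 1 j := by
  rw [Matrix.SpecialLinearGroup.coe_mul, Matrix.mul_apply, Fin.sum_univ_two]

lemma auxSL2_inv {F : Type*} [CommRing F] (A : SL2 F) :
    A⁻¹ 0 0 = A 1 1 ∧ A⁻¹ 0 1 = - A 0 1 ∧ A⁻¹ 1 0 = - A 1 0 ∧ A⁻¹ 1 1 = A 0 0 := by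
  rw [Matrix.SpecialLinearGroup.SL2_inv_expl]
  exact ⟨rfl, rfl, rfl, rfl⟩

/-- The upper triangular subgroup of `SL₂(F)`. -/
def auxBorelSL (F : Type*) [Field F] : Subgroup (SL2 F) where
  carrier := {A | A 1 0 = 0}
  mul_mem' := by
    intro a b ha hb
    simp only [Set.mem_ofPred_eq] at ha hb ⊢
    simp [Matrix.mul_apply, Fin.sum_univ_two, ha, hb]
  one_mem' := by simp
  inv_mem' := by
    intro a ha
    simp only [Set.mem_ofPred_eq] at ha ⊢
    rw [Matrix.SpecialLinearGroup.SL2_inv_expl]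
    simp [ha]

lemma auxBorelSL_mem {F : Type*} [Field F] (A : SL2 F) : A ∈ auxBorelSL F ↔ A 1 0 = 0 := Iff.rfl

/-- The image of the upper triangular subgroup in `PSL₂(F)`. -/
def auxBorel (F : Type*) [Field F] : Subgroup (PSL2 F) :=
  (auxBorelSL F).map (QuotientGroup.mk' _)

lemma auxBorel_mk {F : Type*} [Field F] (A : SL2 F) :
    (QuotientGroup.mk A : PSL2 F) ∈ auxBorel F ↔ A 1 0 = 0 := by
  constructor
  · rintro ⟨B, hB, hBA⟩
    have h1 : B⁻¹ * A ∈ Subgroup.center (SL2 F) := QuotientGroup.eq.1 hBA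
    have h2 : B⁻¹ * A ∈ auxBorelSL F := by
      obtain ⟨r, _, hr⟩ := Matrix.SpecialLinearGroup.mem_center_iff.1 h1
      rw [auxBorelSL_mem, ← hr]
      simp
    have h3 := (auxBorelSL F).mul_mem hB h2
    rwa [mul_inv_cancel_left] at h3
  · intro h
    exact ⟨A, h, rfl⟩

/-- The automorphisms stabilizing the Borel subgroup. -/
def auxStab (F : Type*) [Field F] : Subgroup (MulAut (PSL2 F)) where
  carrier := {α | ∀ s, α s ∈ auxBorel F ↔ s ∈ auxBorel F}
  mul_mem' := by
    intro a b ha hb s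
    rw [MulAut.mul_apply, ha, hb]
  one_mem' := fun s => Iff.rfl
  inv_mem' := by
    intro a ha s
    rw [← ha (a⁻¹ s), MulAut.apply_inv_self]

lemma auxStab_conj {F : Type*} [Field F] (A : SL2 F) :
    MulAut.conj (QuotientGroup.mk A : PSL2 F) ∈ auxStab F ↔ A 1 0 = 0 := by
  constructor
  · intro h
    let E : SL2 F := ⟨!![1, 1; 0, 1], by simp [Matrix.det_fin_two]⟩
    have h1 := (h (QuotientGroup.mk E)).2 ((auxBorel_mk E).2 (by simp [E]))
    rw [MulAut.conj_apply] at h1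
    have h2 : (A * E * A⁻¹) 1 0 = 0 := (auxBorel_mk (A * E * A⁻¹)).1 h1
    obtain ⟨i1, i2, i3, i4⟩ := auxSL2_inv A
    have e1 : E 0 0 = 1 := rfl
    have e2 : E 0 1 = 1 := rfl
    have e3 : E 1 0 = 0 := rfl
    have e4 : E 1 1 = 1 := rfl
    simp only [auxSL2_mul, i1, i3, e1, e2, e3, e4] at h2
    have h3 : A 1 0 * A 1 0 = 0 := by linear_combination -h2
    exact mul_self_eq_zero.1 h3
  · intro h s
    have hA := (auxBorel_mk A).2 h
    rw [MulAut.conj_apply]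
    constructor
    · intro h1
      have h2 := (auxBorel F).mul_mem ((auxBorel F).mul_mem ((auxBorel F).inv_mem hA) h1) hA
      simpa [mul_assoc] using h2
    · intro h1
      exact (auxBorel F).mul_mem ((auxBorel F).mul_mem hA h1) ((auxBorel F).inv_mem hA)

lemma auxStab_field {F : Type*} [Field F] (α : MulAut (PSL2 F)) (hα : IsFieldAutPSL2 α) :
    α ∈ auxStab F := by
  obtain ⟨σ, hσ⟩ := hα
  intro s
  obtain ⟨A, rfl⟩ := QuotientGroup.mk_surjective s
  rw [hσ, auxBorel_mk, auxBorel_mk]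
  simp

/-- Odd exponent of the Borel subgroup. -/
lemma auxBorel_pow {F : Type*} [Field F] [Fintype F] [CharP F 3] (A : SL2 F) (hA : A 1 0 = 0) :
    (QuotientGroup.mk A : PSL2 F) ^ (Fintype.card F / 2 * 3) = 1 := by
  have hF : ringChar F ≠ 2 := by
    rw [ringChar.eq F 3]
    norm_num
  have h3 : (3 : F) = 0 := by exact_mod_cast CharP.cast_eq_zero F 3
  have hdet : A 0 0 * A 1 1 = 1 := by
    have := A.det_coe
    rw [Matrix.det_fin_two, hA, mul_zero, sub_zero] at this
    exact this
  have hpow : ∀ k : ℕ, (A ^ k) 1 0 = 0 ∧ (A ^ k) 0 0 = A 0 0 ^ k ∧ (A ^ k) 1 1 = A 1 1 ^ k := by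
    intro k
    induction k with
    | zero => simp
    | succ k ih =>
      obtain ⟨h1, h2, h3⟩ := ih
      rw [pow_succ]
      refine ⟨?_, ?_, ?_⟩
      · rw [Matrix.SpecialLinearGroup.coe_mul, Matrix.mul_apply, Fin.sum_univ_two, h1, hA]; ring
      · rw [Matrix.SpecialLinearGroup.coe_mul, Matrix.mul_apply, Fin.sum_univ_two, h2, hA]; ring
      · rw [Matrix.SpecialLinearGroup.coe_mul, Matrix.mul_apply, Fin.sum_univ_two, h3, h1]; ring
  obtain ⟨h1, h2, h4⟩ := hpow (Fintype.card F / 2)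
  have hd : A 0 0 ^ (Fintype.card F / 2) * A 1 1 ^ (Fintype.card F / 2) = 1 := by
    rw [← mul_pow, hdet, one_pow]
  have ha0 : A 0 0 ≠ 0 := left_ne_zero_of_mul_eq_one hdet
  obtain ⟨ε, hε, ha, hdd⟩ : ∃ ε : F, ε ^ 2 = 1 ∧ A 0 0 ^ (Fintype.card F / 2) = ε ∧
      A 1 1 ^ (Fintype.card F / 2) = ε := by
    rcases FiniteField.pow_dichotomy hF ha0 with h | h
    · exact ⟨1, one_pow _, h, by rwa [h, one_mul] at hd⟩
    · refine ⟨-1, by ring, h, ?_⟩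
      rw [h] at hd
      linear_combination -hd
  have hmat : ((A ^ (Fintype.card F / 2) : SL2 F) : Matrix (Fin 2) (Fin 2) F) =
      !![ε, (A ^ (Fintype.card F / 2)) 0 1; 0, ε] := by
    ext i j
    fin_cases i <;> fin_cases j
    · exact h2.trans ha
    · rfl
    · exact h1
    · exact h4.trans hdd
  show (QuotientGroup.mk (A ^ (Fintype.card F / 2 * 3)) : PSL2 F) = 1
  rw [QuotientGroup.eq_one_iff, Matrix.SpecialLinearGroup.mem_center_iff]
  refine ⟨ε, by simpa using hε, ?_⟩
  rw [pow_mul, Matrix.SpecialLinearGroup.coe_pow, hmat]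
  have he3 : ε ^ 3 = ε := by rw [pow_succ, hε, one_mul]
  ext i j
  fin_cases i <;> fin_cases j
  · simp [pow_succ, Matrix.mul_apply, Fin.sum_univ_two]
    linear_combination -he3
  · simp [pow_succ, Matrix.mul_apply, Fin.sum_univ_two]
    linear_combination -(ε ^ 2 * (A ^ (Fintype.card F / 2)) 0 1) * h3
  · simp [pow_succ, Matrix.mul_apply, Fin.sum_univ_two]
  · simp [pow_succ, Matrix.mul_apply, Fin.sum_univ_two]
    linear_combination -he3

/-- Upper unipotent elements. -/
def auxU {F : Type*} [Field F] (x : F) : SL2 F := ⟨!![1, x; 0, 1], by simp [Matrix.det_fin_two]⟩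

/-- The Weyl element. -/
def auxW (F : Type*) [Field F] : SL2 F := ⟨!![0, -1; 1, 0], by simp [Matrix.det_fin_two]⟩

lemma auxUW_10 {F : Type*} [Field F] (x : F) : (auxU x * auxW F) 1 0 = 1 := by
  rw [auxSL2_mul]
  show (0 : F) * 0 + 1 * 1 = 1
  ring

lemma auxUW_00 {F : Type*} [Field F] (x : F) : (auxU x * auxW F) 0 0 = x := by
  rw [auxSL2_mul]
  show (1 : F) * 0 + x * 1 = x
  ring

lemma auxUW_entry {F : Type*} [Field F] (x : F) (A : SL2 F) :
    ((auxU x * auxW F)⁻¹ * A) 1 0 = x * A 1 0 - A 0 0 := by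
  obtain ⟨i1, i2, i3, i4⟩ := auxSL2_inv (auxU x * auxW F)
  rw [auxSL2_mul, i3, i4, auxUW_10, auxUW_00]
  ring

lemma aux_odd_card (f : ℕ) (hf : Odd f) : Odd (3 ^ f / 2 * 3) := by
  obtain ⟨k, rfl⟩ := hf
  have h : 3 ^ (2 * k + 1) % 4 = 3 := by
    rw [pow_succ, pow_mul, Nat.mul_mod, Nat.pow_mod]
    simp
  generalize 3 ^ (2 * k + 1) = m at h
  rw [Nat.odd_iff]
  omega

end aux

/-- Let `S = PSL₂(3^f)` (`f ≥ 3` odd) and `Inn(S) ≤ G ≤ Aut(S)` with `G/Inn(S)` cyclic,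
generated by the image of a field automorphism of odd order dividing `f`. Then `G` has at
most two rational irreducible characters of odd degree; indeed every rational irreducible
character of `G` other than the trivial character and the (unique rational) extension of
the Steinberg character of `S` (the character restricting to `Inn(S)` as an irreducible
character of degree `3^f`) has even degree and its kernel does not contain `Inn(S)`. -/
theorem rational_chars_of_almost_simple (f : ℕ) (hf : Odd f) (hf3 : 3 ≤ f)
    (G : Subgroup (MulAut (PSL2 (GaloisField 3 f))))
    (hG : innAut (PSL2 (GaloisField 3 f)) ≤ G)
    (τ : ↥G) (hτ : IsFieldAutPSL2 (↑τ : MulAut (PSL2 (GaloisField 3 f))))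
    (hgen : ∀ y : ↥G ⧸ (innAut (PSL2 (GaloisField 3 f))).subgroupOf G,
      y ∈ Subgroup.zpowers (QuotientGroup.mk τ))
    (hodd : Odd (orderOf (QuotientGroup.mk τ :
      ↥G ⧸ (innAut (PSL2 (GaloisField 3 f))).subgroupOf G)))
    (hdvd : orderOf (QuotientGroup.mk τ :
      ↥G ⧸ (innAut (PSL2 (GaloisField 3 f))).subgroupOf G) ∣ f) :
    (∃ c₁ c₂ : ↥G → ℂ, ∀ V : FDRep ℂ ↥G, Simple V →
      (∀ g : ↥G, ∃ q : ℚ, V.character g = (q : ℂ)) → Odd (Module.finrank ℂ V) →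
      V.character = c₁ ∨ V.character = c₂) ∧
    ∀ V : FDRep ℂ ↥G, Simple V → (∀ g : ↥G, ∃ q : ℚ, V.character g = (q : ℂ)) →
      (¬ ∀ g : ↥G, V.character g = 1) →
      (¬ ∃ W : FDRep ℂ ↥((innAut (PSL2 (GaloisField 3 f))).subgroupOf G), Simple W ∧
        Module.finrank ℂ W = 3 ^ f ∧
        ∀ s : ↥((innAut (PSL2 (GaloisField 3 f))).subgroupOf G),
          W.character s = V.character ↑s) →
      Even (Module.finrank ℂ V) ∧
        ∃ g : ↥G, (↑g : MulAut (PSL2 (GaloisField 3 f))) ∈ innAut (PSL2 (GaloisField 3 f)) ∧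
          V.character g ≠ V.character 1 := by
  classical
  set F := GaloisField 3 f with hFdef
  have : Fintype F := Fintype.ofFinite F
  have hf0 : f ≠ 0 := by omega
  have hcard : Nat.card F = 3 ^ f := GaloisField.card 3 f hf0
  have hchar : CharP F 3 := inferInstance
  have hfinAut : Finite (MulAut (PSL2 F)) :=
    Finite.of_injective (fun e : MulAut (PSL2 F) => (e : PSL2 F → PSL2 F)) DFunLike.coe_injective
  have hfin : Finite ↥G := inferInstance
  set N : Subgroup ↥G := (innAut (PSL2 F)).subgroupOf G with hN
  let H : Subgroup ↥G := (auxStab F).subgroupOf G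
  let c : SL2 F → ↥G := fun A => ⟨MulAut.conj (QuotientGroup.mk A), hG ⟨_, rfl⟩⟩
  have hcmul : ∀ A B, c (A * B) = c A * c B := by
    intro A B
    apply Subtype.ext
    show MulAut.conj (QuotientGroup.mk (A * B) : PSL2 F) = _
    rw [QuotientGroup.mk_mul, map_mul]
    rfl
  have hcinv : ∀ A, c A⁻¹ = (c A)⁻¹ := by
    intro A
    apply Subtype.ext
    show MulAut.conj (QuotientGroup.mk (A⁻¹) : PSL2 F) = _
    rw [QuotientGroup.mk_inv, map_inv]
    rfl
  have hcN : ∀ A, c A ∈ N := fun A => ⟨_, rfl⟩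
  have hcN' : ∀ n ∈ N, ∃ A, c A = n := by
    rintro n ⟨s, hs⟩
    obtain ⟨A, rfl⟩ := QuotientGroup.mk_surjective s
    exact ⟨A, Subtype.ext hs⟩
  have hcH : ∀ A, c A ∈ H ↔ A 1 0 = 0 := fun A => auxStab_conj A
  have hτH : τ ∈ H := auxStab_field _ hτ
  have hinv : ∀ h ∈ H, h * h = 1 → h = 1 := by
    intro h hh h2
    rw [← pow_two] at h2
    have hmem : h ∈ N := by
      rw [← QuotientGroup.eq_one_iff]
      obtain ⟨k, hk⟩ := hgen (QuotientGroup.mk h)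
      have h3 : (QuotientGroup.mk h : ↥G ⧸ N) ^ orderOf (QuotientGroup.mk τ : ↥G ⧸ N) = 1 := by
        rw [← hk]
        simp only
        rw [← zpow_natCast, zpow_comm, zpow_natCast, pow_orderOf_eq_one, one_zpow]
      have h4 : (QuotientGroup.mk h : ↥G ⧸ N) ^ 2 = 1 := by
        rw [← QuotientGroup.mk_pow, h2, QuotientGroup.mk_one]
      have h5 := pow_gcd_eq_one.2 ⟨h3, h4⟩
      rwa [(Nat.coprime_two_right.2 hodd).gcd_eq_one, pow_one] at h5
    obtain ⟨A, rfl⟩ := hcN' h hmem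
    have hA := (hcH A).1 hh
    have h3 : c A ^ (Fintype.card F / 2 * 3) = 1 := by
      apply Subtype.ext
      show MulAut.conj (QuotientGroup.mk A : PSL2 F) ^ (Fintype.card F / 2 * 3) = 1
      rw [← map_pow, auxBorel_pow A hA, map_one]
    have h5 := pow_gcd_eq_one.2 ⟨h3, h2⟩
    have hoddk : Odd (Fintype.card F / 2 * 3) := by
      rw [← Nat.card_eq_fintype_card, hcard]
      exact aux_odd_card f hf
    rwa [(Nat.coprime_two_right.2 hoddk).gcd_eq_one, pow_one] at h5
  have hcov : ∀ g, g ∈ H ∨ ∃ x, (c (auxU x) * c (auxW F))⁻¹ * g ∈ H := by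
    intro g
    obtain ⟨k, hk⟩ := hgen (QuotientGroup.mk g)
    have h1 : g * (τ ^ k)⁻¹ ∈ N := by
      rw [← QuotientGroup.eq_one_iff, QuotientGroup.mk_mul, QuotientGroup.mk_inv,
        QuotientGroup.mk_zpow, ← hk]
      exact mul_inv_cancel _
    have hτk : τ ^ k ∈ H := H.zpow_mem hτH k
    obtain ⟨A, hA⟩ := hcN' _ h1
    have hg : g = c A * τ ^ k := by rw [hA]; group
    by_cases h0 : A 1 0 = 0
    · left
      rw [hg]
      exact H.mul_mem ((hcH A).2 h0) hτk
    · right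
      refine ⟨A 0 0 / A 1 0, ?_⟩
      rw [hg, ← mul_assoc, ← hcmul, ← hcinv, ← hcmul]
      refine H.mul_mem ((hcH _).2 ?_) hτk
      rw [auxUW_entry, div_mul_cancel₀ _ h0, sub_self]
  have hmain := aux_main N H (F := F) (fun x => c (auxU x)) (c (auxW F)) (fun x => hcN _) (hcN _)
    (fun x => (hcH _).2 (by simp [auxU])) hcov
    (fun x hx => by
      rw [← hcmul, hcH, auxUW_10] at hx
      exact one_ne_zero hx)
    (fun x y hxy => by
      rw [← hcmul, ← hcmul, ← hcinv, ← hcmul, hcH, auxUW_entry, auxUW_10, auxUW_00, mul_one] at hxy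
      exact sub_eq_zero.1 hxy)
    hinv
  constructor
  · by_cases hex : ∃ V0 : FDRep ℂ ↥G, Simple V0 ∧
        (∀ g : ↥G, ∃ q : ℚ, V0.character g = (q : ℂ)) ∧ Odd (Module.finrank ℂ V0) ∧
        ¬ ∀ g : ↥G, V0.character g = 1
    · obtain ⟨V0, hV0, hr0, ho0, hn0⟩ := hex
      refine ⟨fun _ => 1, V0.character, fun V hV hr ho => ?_⟩
      by_cases hn : ∀ g : ↥G, V.character g = 1
      · exact Or.inl (funext hn)
      right
      have := Fintype.ofFinite (↥G ⧸ H)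
      obtain ⟨P, hP, hPs, hPk⟩ := ((hmain V hV hr ho).resolve_left hn).2.2
      obtain ⟨Q, hQ, hQs, hQk⟩ := ((hmain V0 hV0 hr0 ho0).resolve_left hn0).2.2
      funext g
      refine aux_char_eq V.ρ V0.ρ P hP Q hQ hPs hQs ?_ g
      ext x
      rw [LinearMap.mem_ker, LinearMap.mem_ker, hPk, hQk]
    · refine ⟨fun _ => 1, fun _ => 1, fun V hV hr ho => Or.inl ?_⟩
      by_contra hn
      exact hex ⟨V, hV, hr, ho, fun h => hn (funext h)⟩
  · intro V hV hr hn hSt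
    constructor
    · by_contra hev
      have ho : Odd (Module.finrank ℂ V) := Nat.not_even_iff_odd.1 hev
      obtain ⟨h1, h2, -⟩ := (hmain V hV hr ho).resolve_left hn
      apply hSt
      have hpos : 0 < Module.finrank ℂ V := ho.pos
      have hnt : Nontrivial V := Module.finrank_pos_iff.1 hpos
      let σ : Representation ℂ N V := V.ρ.comp N.subtype
      refine ⟨FDRep.of σ, ?_, h1.trans hcard, fun s => rfl⟩
      exact aux_irr_simple (FDRep.of σ) (exists_ne (0 : V))
        (fun M hM => h2 M fun n hn v hv => hM ⟨n, hn⟩ v hv)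
    · by_contra hcon
      push Not at hcon
      exact hn (aux_kernel N τ hgen hodd V hV hr (fun g hg => hcon g hg))
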